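/- arXiv:1001.0137 — 10 statements merged into one kernel-verified Lean document; each statement's English description precedes it below -/
import Mathlib

section
/- Let h, φ : ℝ → ℝ be differentiable, let u : ℝ → ℝ² be a differentiable hyperbolic-number-valued curve, and let x : ℝ → ℝ² be a differentiable hyperbolic-number-valued curve (a moving point of the moving plane). Define the absolute velocity V_a(t) as the derivative of t ↦ (h(t)·x(t) − u(t))·e^{jφ(t)}, the relative velocity V_r(t) = h(t)·ẋ(t)·e^{jφ(t)}, and the sliding velocity V_f(t) = [(ḣ(t) + j h(t) φ̇(t))·x(t) − (u̇(t) + j φ̇(t)·u(t))]·e^{jφ(t)} (all products being hyperbolic-number products). Then for every t, V_a(t) = V_f(t) + V_r(t). -/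
/-- Hyperbolic (split-complex) numbers, identified with pairs of reals:
`z = z₁ + j z₂ ↔ (z₁, z₂)`. -/
abbrev Hyp : Type := ℝ × ℝ

/-- The hyperbolic-number product:
`(z₁ + j z₂)(w₁ + j w₂) = (z₁w₁ + z₂w₂) + j (z₁w₂ + z₂w₁)`. -/
def hmul (z w : Hyp) : Hyp := (z.1 * w.1 + z.2 * w.2, z.1 * w.2 + z.2 * w.1)

/-- The hyperbolic imaginary unit `j`. -/
def jh : Hyp := (0, 1)

/-- The hyperbolic exponential `e^{jφ} = cosh φ + j sinh φ`. -/
noncomputable def hexp (φ : ℝ) : Hyp := (Real.cosh φ, Real.sinh φ)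

/-- The hyperbolic modulus `‖z‖ₕ = √|z₁² − z₂²|`. -/
noncomputable def hnorm (z : Hyp) : ℝ := Real.sqrt |z.1 ^ 2 - z.2 ^ 2|

/-- The hyperbolic inner product `⟨z, w⟩ = z₁w₁ − z₂w₂`. -/
def hinner (z w : Hyp) : ℝ := z.1 * w.1 - z.2 * w.2

/-- Leibniz rule for the hyperbolic product. -/
theorem HasDerivAt.hmul {f g : ℝ → Hyp} {f' g' : Hyp} {t : ℝ}
    (hf : HasDerivAt f f' t) (hg : HasDerivAt g g' t) :
    HasDerivAt (fun s => _root_.hmul (f s) (g s))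
      (_root_.hmul f' (g t) + _root_.hmul (f t) g') t := by
  have hf₁ : HasDerivAt (fun s => (f s).1) f'.1 t := hf.fst
  have hf₂ : HasDerivAt (fun s => (f s).2) f'.2 t := hf.snd
  have hg₁ : HasDerivAt (fun s => (g s).1) g'.1 t := hg.fst
  have hg₂ : HasDerivAt (fun s => (g s).2) g'.2 t := hg.snd
  refine (((hf₁.mul hg₁).add (hf₂.mul hg₂)).prodMk
    ((hf₁.mul hg₂).add (hf₂.mul hg₁))).congr_deriv ?_
  ext <;> simp only [_root_.hmul, Prod.fst_add, Prod.snd_add] <;> ring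

/-- The derivative of `e^{jφ}` is `j φ' e^{jφ}`. -/
theorem HasDerivAt.hexp {φ : ℝ → ℝ} {φ' t : ℝ} (hφ : HasDerivAt φ φ' t) :
    HasDerivAt (fun s => _root_.hexp (φ s)) (_root_.hmul (0, φ') (_root_.hexp (φ t))) t := by
  refine (hφ.cosh.prodMk hφ.sinh).congr_deriv ?_
  ext <;> simp only [_root_.hmul, _root_.hexp] <;> ring

/-- In the one-parameter planar homothetic hyperbolic motion
`x ↦ x' = (h x − u) e^{jφ}`, the absolute velocity is the sum of the sliding
velocity and the relative velocity: `V_a = V_f + V_r`. -/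
theorem velocity_composition
    (h φ : ℝ → ℝ) (u x : ℝ → Hyp)
    (hh : Differentiable ℝ h) (hφ : Differentiable ℝ φ)
    (hu : Differentiable ℝ u) (hx : Differentiable ℝ x)
    (Va Vr Vf : ℝ → Hyp)
    (hVa : Va = deriv (fun t => hmul (h t • x t - u t) (hexp (φ t))))
    (hVr : ∀ t, Vr t = hmul (h t • deriv x t) (hexp (φ t)))
    (hVf : ∀ t, Vf t =
      hmul (hmul (deriv h t, h t * deriv φ t) (x t)
            - (deriv u t + hmul (0, deriv φ t) (u t))) (hexp (φ t))) :
    ∀ t, Va t = Vf t + Vr t := by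
  intro t
  have hpos := ((hh t).hasDerivAt.smul (hx t).hasDerivAt).sub (hu t).hasDerivAt
  have hderiv := (hpos.hmul (hφ t).hasDerivAt.hexp).deriv
  simp only [Pi.sub_apply, Pi.smul_apply'] at hderiv
  rw [hVa, hVf, hVr]
  refine hderiv.trans ?_
  ext <;> simp only [hmul, hexp, Prod.fst_add, Prod.snd_add, Prod.fst_sub, Prod.snd_sub,
    Prod.smul_fst, Prod.smul_snd, smul_eq_mul] <;> ring
end

section
/- Let h, φ : ℝ → ℝ be differentiable, let u : ℝ → ℝ² be a differentiable hyperbolic-number-valued curve, and fix t with ḣ(t)² − h(t)²·φ̇(t)² ≠ 0. Then there is a unique hyperbolic number p (the rotation pole) such that (ḣ(t) + j h(t) φ̇(t))·p = u̇(t) + j φ̇(t)·u(t) (equivalently, the sliding velocity V_f vanishes at x = p), and its coordinates are p₁ = [(u̇₁ + φ̇ u₂)·ḣ − (u̇₂ + φ̇ u₁)·h φ̇] / (ḣ² − h² φ̇²) and p₂ = [(u̇₂ + φ̇ u₁)·ḣ − (u̇₁ + φ̇ u₂)·h φ̇] / (ḣ² − h² φ̇²), all evaluated at t. -/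
/-- Division by a hyperbolic number off the null cone, in coordinates. -/
theorem hmul_eq_iff {a : Hyp} (ha : a.1 ^ 2 - a.2 ^ 2 ≠ 0) (p c : Hyp) :
    hmul a p = c ↔
      p = ((c.1 * a.1 - c.2 * a.2) / (a.1 ^ 2 - a.2 ^ 2),
        (c.2 * a.1 - c.1 * a.2) / (a.1 ^ 2 - a.2 ^ 2)) := by
  constructor
  · rintro rfl
    ext <;> simp only [hmul] <;> rw [eq_div_iff ha] <;> ring
  · rintro rfl
    ext <;> simp only [hmul] <;> field_simp <;> ring

/-- When `ḣ² − h²φ̇² ≠ 0` there is a unique rotation pole `p`,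
i.e. a unique hyperbolic number with `(ḣ + j h φ̇) p = u̇ + j φ̇ u` (so that the
sliding velocity vanishes at `p`), and its coordinates are the stated ones. -/
theorem rotation_pole_existsUnique
    (h φ : ℝ → ℝ) (u : ℝ → Hyp)
    (hh : Differentiable ℝ h) (hφ : Differentiable ℝ φ) (hu : Differentiable ℝ u)
    (t : ℝ)
    (hne : (deriv h t) ^ 2 - (h t) ^ 2 * (deriv φ t) ^ 2 ≠ 0) :
    (∃! p : Hyp,
        hmul (deriv h t, h t * deriv φ t) p = deriv u t + hmul (0, deriv φ t) (u t)) ∧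
    hmul (deriv h t, h t * deriv φ t)
        ((((deriv u t).1 + deriv φ t * (u t).2) * deriv h t
            - ((deriv u t).2 + deriv φ t * (u t).1) * (h t * deriv φ t))
          / ((deriv h t) ^ 2 - (h t) ^ 2 * (deriv φ t) ^ 2),
         (((deriv u t).2 + deriv φ t * (u t).1) * deriv h t
            - ((deriv u t).1 + deriv φ t * (u t).2) * (h t * deriv φ t))
          / ((deriv h t) ^ 2 - (h t) ^ 2 * (deriv φ t) ^ 2))
      = deriv u t + hmul (0, deriv φ t) (u t) := by
  have hne' : (deriv h t) ^ 2 - (h t * deriv φ t) ^ 2 ≠ 0 := by rwa [mul_pow]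
  have key := hmul_eq_iff (a := (deriv h t, h t * deriv φ t)) hne'
  refine ⟨⟨_, (key _ _).2 rfl, fun p hp => (key _ _).1 hp⟩, (key _ _).2 ?_⟩
  simp [hmul, mul_pow]
end

section
/- Let h, φ : ℝ → ℝ be differentiable, u : ℝ → ℝ² a differentiable hyperbolic-number-valued curve, fix t with ḣ(t)² − h(t)²·φ̇(t)² ≠ 0, and let p be the rotation pole at time t (the hyperbolic number with (ḣ + j h φ̇)·p = u̇ + j φ̇·u). Then for every hyperbolic number x = x₁ + j x₂, the hyperbolic modulus of the sliding velocity satisfies ‖V_f‖ₕ = √(|ḣ² − h² φ̇²|) · √(|(x₁ − p₁)² − (x₂ − p₂)²|), all functions evaluated at t. -/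
theorem hmul_sub_hmul (a z w : Hyp) : hmul a z - hmul a w = hmul a (z - w) := by
  ext <;> simp only [hmul, Prod.fst_sub, Prod.snd_sub] <;> ring

theorem hnorm_hmul (z w : Hyp) : hnorm (hmul z w) = hnorm z * hnorm w := by
  rw [hnorm, hnorm, hnorm, ← Real.sqrt_mul (abs_nonneg _), ← abs_mul]
  congr 2
  simp only [hmul]
  ring

theorem hnorm_hexp (a : ℝ) : hnorm (hexp a) = 1 := by
  simp [hnorm, hexp, Real.cosh_sq_sub_sinh_sq]

/-- The hyperbolic modulus of the sliding velocity is
`‖V_f‖ₕ = √|ḣ² − h²φ̇²| · √|(x₁ − p₁)² − (x₂ − p₂)²|`. -/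
theorem sliding_velocity_hnorm
    (h φ : ℝ → ℝ) (u : ℝ → Hyp)
    (hh : Differentiable ℝ h) (hφ : Differentiable ℝ φ) (hu : Differentiable ℝ u)
    (t : ℝ)
    (hne : (deriv h t) ^ 2 - (h t) ^ 2 * (deriv φ t) ^ 2 ≠ 0)
    (p : Hyp)
    (hp : hmul (deriv h t, h t * deriv φ t) p = deriv u t + hmul (0, deriv φ t) (u t)) :
    ∀ x : Hyp,
      hnorm (hmul (hmul (deriv h t, h t * deriv φ t) x
              - (deriv u t + hmul (0, deriv φ t) (u t))) (hexp (φ t)))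
        = Real.sqrt |(deriv h t) ^ 2 - (h t) ^ 2 * (deriv φ t) ^ 2|
            * Real.sqrt |(x.1 - p.1) ^ 2 - (x.2 - p.2) ^ 2| := by
  intro x
  rw [← hp, hmul_sub_hmul, hnorm_hmul, hnorm_hmul, hnorm_hexp, mul_one]
  simp only [hnorm, Prod.fst_sub, Prod.snd_sub, mul_pow]
end

section
/- Let φ : ℝ → ℝ be differentiable with φ̇(t) ≠ 0, let u : ℝ → ℝ² be a differentiable hyperbolic-number-valued curve, take homothetic scale h identically 1, and let p be the rotation pole at time t (the hyperbolic number with j φ̇·p = u̇ + j φ̇·u). Then for every hyperbolic number x, the hyperbolic modulus of the sliding velocity satisfies ‖V_f‖ₕ = |φ̇| · ‖(x − p)·e^{jφ}‖ₕ. -/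
theorem hmul_sub (a x y : Hyp) : hmul a (x - y) = hmul a x - hmul a y := by
  ext <;> simp only [hmul, Prod.fst_sub, Prod.snd_sub] <;> ring

theorem hmul_assoc (a b c : Hyp) : hmul (hmul a b) c = hmul a (hmul b c) := by
  ext <;> simp only [hmul] <;> ring

theorem hnorm_zero_left (a : ℝ) : hnorm (0, a) = |a| := by
  simp [hnorm, Real.sqrt_sq_eq_abs]

/-- For `h ≡ 1`, the hyperbolic modulus of the sliding
velocity satisfies `‖V_f‖ₕ = |φ̇| ‖(x − p) e^{jφ}‖ₕ`. -/
theorem sliding_velocity_hnorm_h_eq_one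
    (φ : ℝ → ℝ) (u : ℝ → Hyp)
    (hφ : Differentiable ℝ φ) (hu : Differentiable ℝ u)
    (t : ℝ) (hne : deriv φ t ≠ 0)
    (p : Hyp)
    (hp : hmul (0, deriv φ t) p = deriv u t + hmul (0, deriv φ t) (u t)) :
    ∀ x : Hyp,
      hnorm (hmul (hmul (0, deriv φ t) x - (deriv u t + hmul (0, deriv φ t) (u t)))
          (hexp (φ t)))
        = |deriv φ t| * hnorm (hmul (x - p) (hexp (φ t))) := by
  intro x
  rw [← hp, ← hmul_sub, hmul_assoc, hnorm_hmul, hnorm_zero_left]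
end

section
/- Let h, φ : ℝ → ℝ and u, p : ℝ → ℝ² be differentiable, where p is the moving pole curve, i.e. for every t the hyperbolic-number identity (ḣ(t) + j h(t) φ̇(t))·p(t) = u̇(t) + j φ̇(t)·u(t) holds. Define the fixed pole curve p'(t) = (h(t)·p(t) − u(t))·e^{jφ(t)}. Then for every t, ṗ'(t) = h(t)·ṗ(t)·e^{jφ(t)} (hyperbolic-number product); in other words, after the hyperbolic rotation by φ and scaling by h, the tangent vectors of the moving and fixed pole curves at corresponding points coincide. -/
/-- The product rule for the hyperbolic-number product. -/
theorem hasDerivAt_hmul {z w : ℝ → Hyp} {z' w' : Hyp} {t : ℝ}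
    (hz : HasDerivAt z z' t) (hw : HasDerivAt w w' t) :
    HasDerivAt (fun s => hmul (z s) (w s)) (hmul z' (w t) + hmul (z t) w') t := by
  have fst_deriv {f : ℝ → Hyp} {f' : Hyp} (hf : HasDerivAt f f' t) :
      HasDerivAt (fun s => (f s).1) f'.1 t :=
    (ContinuousLinearMap.fst ℝ ℝ ℝ).hasFDerivAt.comp_hasDerivAt t hf
  have snd_deriv {f : ℝ → Hyp} {f' : Hyp} (hf : HasDerivAt f f' t) :
      HasDerivAt (fun s => (f s).2) f'.2 t :=
    (ContinuousLinearMap.snd ℝ ℝ ℝ).hasFDerivAt.comp_hasDerivAt t hf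
  have h := (((fst_deriv hz).mul (fst_deriv hw)).add ((snd_deriv hz).mul (snd_deriv hw))).prodMk
    (((fst_deriv hz).mul (snd_deriv hw)).add ((snd_deriv hz).mul (fst_deriv hw)))
  refine h.congr_deriv ?_
  simp only [hmul, Prod.mk_add_mk, Prod.mk.injEq]
  constructor <;> ring

/-- The derivative of `e^{jφ}` is `j φ̇ e^{jφ}`. -/
theorem hasDerivAt_hexp {φ : ℝ → ℝ} {φ' t : ℝ} (hφ : HasDerivAt φ φ' t) :
    HasDerivAt (fun s => hexp (φ s)) (hmul (0, φ') (hexp (φ t))) t := by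
  refine (hφ.cosh.prodMk hφ.sinh).congr_deriv ?_
  simp only [hmul, hexp, Prod.mk.injEq]
  constructor <;> ring

/-- If `p` is the moving pole curve (satisfying the pole
identity `(ḣ + j h φ̇) p = u̇ + j φ̇ u` for all `t`) and
`p' = (h p − u) e^{jφ}` is the fixed pole curve, then `ṗ' = h ṗ e^{jφ}`:
the tangent vectors of the two pole curves coincide after the hyperbolic
rotation by `φ` and scaling by `h`. -/
theorem pole_curve_tangents
    (h φ : ℝ → ℝ) (u p : ℝ → Hyp)
    (hh : Differentiable ℝ h) (hφ : Differentiable ℝ φ)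
    (hu : Differentiable ℝ u) (hp : Differentiable ℝ p)
    (hpole : ∀ t, hmul (deriv h t, h t * deriv φ t) (p t)
      = deriv u t + hmul (0, deriv φ t) (u t))
    (p' : ℝ → Hyp)
    (hp' : ∀ t, p' t = hmul (h t • p t - u t) (hexp (φ t))) :
    ∀ t, deriv p' t = hmul (h t • deriv p t) (hexp (φ t)) := by
  intro t
  have key := hasDerivAt_hmul
    (((hh t).hasDerivAt.smul (hp t).hasDerivAt).sub (hu t).hasDerivAt)
    (hasDerivAt_hexp (hφ t).hasDerivAt)
  have hderiv := key.congr_of_eventuallyEq (Filter.Eventually.of_forall hp')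
  rw [hderiv.deriv]
  have h₁ := congrArg Prod.fst (hpole t)
  have h₂ := congrArg Prod.snd (hpole t)
  simp only [hmul, Prod.fst_add, Prod.snd_add] at h₁ h₂
  ext <;> simp [hmul, hexp]
  · linear_combination Real.cosh (φ t) * h₁ + Real.sinh (φ t) * h₂
  · linear_combination Real.sinh (φ t) * h₁ + Real.cosh (φ t) * h₂
end

section
/- (Theorem 2) Let h, φ : ℝ → ℝ and u, x, p : ℝ → ℝ² be twice differentiable, where for every t the pole identity (ḣ + j h φ̇)·p = u̇ + j φ̇·u holds. Define the absolute acceleration b_a(t) as the second derivative of t ↦ (h x − u)·e^{jφ}, the relative acceleration b_r = h·ẍ·e^{jφ}, the Coriolis acceleration b_c = 2·ẋ·(ḣ + j h φ̇)·e^{jφ}, and the sliding acceleration b_f = (x − p)·[(ḧ + h φ̇²) + j(2 ḣ φ̇ + h φ̈)]·e^{jφ} − ṗ·(ḣ + j h φ̇)·e^{jφ} (hyperbolic-number products). Then for every t, b_a = b_f + b_c + b_r. -/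
/-- In the frame rotating with angle `φ`, differentiation acts as `z ↦ ż + j φ̇ z`. -/
theorem hasDerivAt_hmul_hexp {z : ℝ → Hyp} {φ : ℝ → ℝ} {z' : Hyp} {φ' t : ℝ}
    (hz : HasDerivAt z z' t) (hφ : HasDerivAt φ φ' t) :
    HasDerivAt (fun s => hmul (z s) (hexp (φ s)))
      (hmul (z' + hmul (0, φ') (z t)) (hexp (φ t))) t := by
  refine (hasDerivAt_hmul hz (hasDerivAt_hexp hφ)).congr_deriv ?_
  ext <;> simp only [hmul, Prod.fst_add, Prod.snd_add] <;> ring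

/-- **Theorem 2.** Composition of accelerations:
`b_a = b_f + b_c + b_r`, where `b_a` is the second derivative of
`t ↦ (h x − u) e^{jφ}`, `b_r = h ẍ e^{jφ}`, `b_c = 2 ẋ (ḣ + j h φ̇) e^{jφ}` and
`b_f = (x − p)[(ḧ + h φ̇²) + j(2 ḣ φ̇ + h φ̈)] e^{jφ} − ṗ (ḣ + j h φ̇) e^{jφ}`. -/
theorem acceleration_composition
    (h φ : ℝ → ℝ) (u x p : ℝ → Hyp)
    (hh : Differentiable ℝ h) (hh' : Differentiable ℝ (deriv h))
    (hφ : Differentiable ℝ φ) (hφ' : Differentiable ℝ (deriv φ))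
    (hu : Differentiable ℝ u) (hu' : Differentiable ℝ (deriv u))
    (hx : Differentiable ℝ x) (hx' : Differentiable ℝ (deriv x))
    (hp : Differentiable ℝ p) (hp' : Differentiable ℝ (deriv p))
    (hpole : ∀ t, hmul (deriv h t, h t * deriv φ t) (p t)
      = deriv u t + hmul (0, deriv φ t) (u t))
    (ba br bc bf : ℝ → Hyp)
    (hba : ba = deriv (deriv (fun t => hmul (h t • x t - u t) (hexp (φ t)))))
    (hbr : ∀ t, br t = hmul (h t • deriv (deriv x) t) (hexp (φ t)))
    (hbc : ∀ t, bc t =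
      hmul ((2 : ℝ) • hmul (deriv x t) (deriv h t, h t * deriv φ t)) (hexp (φ t)))
    (hbf : ∀ t, bf t =
      hmul (hmul (x t - p t)
          (deriv (deriv h) t + h t * (deriv φ t) ^ 2,
           2 * deriv h t * deriv φ t + h t * deriv (deriv φ) t)) (hexp (φ t))
        - hmul (hmul (deriv p t) (deriv h t, h t * deriv φ t)) (hexp (φ t))) :
    ∀ t, ba t = bf t + bc t + br t := by
  have velocity : deriv (fun t => hmul (h t • x t - u t) (hexp (φ t))) = fun t =>
      hmul (h t • deriv x t + hmul (deriv h t, h t * deriv φ t) (x t - p t)) (hexp (φ t)) := by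
    funext t
    have hy := ((hh t).hasDerivAt.smul (hx t).hasDerivAt).sub (hu t).hasDerivAt
    refine (hasDerivAt_hmul_hexp hy (hφ t).hasDerivAt).deriv.trans ?_
    congr 1
    have pole₁ := congrArg Prod.fst (hpole t)
    have pole₂ := congrArg Prod.snd (hpole t)
    simp only [hmul, Prod.fst_add, Prod.snd_add] at pole₁ pole₂
    ext <;> simp [hmul] <;> linarith
  intro t
  have hg := (hh' t).hasDerivAt.prodMk ((hh t).hasDerivAt.mul (hφ' t).hasDerivAt)
  have hv := ((hh t).hasDerivAt.smul (hx' t).hasDerivAt).add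
    (hasDerivAt_hmul hg ((hx t).hasDerivAt.sub (hp t).hasDerivAt))
  rw [hba, velocity, hbr, hbc, hbf]
  refine (hasDerivAt_hmul_hexp hv (hφ t).hasDerivAt).deriv.trans ?_
  ext <;> simp [hmul] <;> ring
end

section
/- (Theorem 3) Let h, φ : ℝ → ℝ and u, p : ℝ → ℝ² be twice differentiable with the pole identity (ḣ + j h φ̇)·p = u̇ + j φ̇·u holding for all t. Fix t, set A = ḧ + h φ̇² and B = 2 ḣ φ̇ + h φ̈, and assume A² − B² ≠ 0 (i.e. ḧ + h φ̇² ≠ ∓(2 ḣ φ̇ + h φ̈)). Then there is a unique hyperbolic number q (the acceleration pole) at which the sliding acceleration b_f = (x − p)·(A + jB)·e^{jφ} − ṗ·(ḣ + j h φ̇)·e^{jφ} vanishes, namely q = p + ṗ·(ḣ + j h φ̇)·(A − jB)/(A² − B²), i.e. q = p + ṗ·(ḣ + j h φ̇)/(A + jB) with division by the invertible hyperbolic number A + jB. -/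
theorem hmul_eq_iff_eq_inv_smul {A B : ℝ} (hne : A ^ 2 - B ^ 2 ≠ 0) (z w : Hyp) :
    hmul z (A, B) = w ↔ z = (A ^ 2 - B ^ 2)⁻¹ • hmul w (A, -B) := by
  constructor
  · rintro rfl
    ext <;> simp only [hmul, Prod.smul_fst, Prod.smul_snd, smul_eq_mul] <;> field_simp <;> ring
  · rintro rfl
    ext <;> simp only [hmul, Prod.smul_fst, Prod.smul_snd, smul_eq_mul] <;> field_simp <;> ring

theorem hmul_hexp_left_inj (z w : Hyp) (θ : ℝ) :
    hmul z (hexp θ) = hmul w (hexp θ) ↔ z = w := by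
  have hne : Real.cosh θ ^ 2 - Real.sinh θ ^ 2 ≠ 0 := by simp [Real.cosh_sq_sub_sinh_sq]
  refine ⟨fun hzw => ?_, fun hzw => hzw ▸ rfl⟩
  rw [(hmul_eq_iff_eq_inv_smul hne z _).1 hzw]
  exact ((hmul_eq_iff_eq_inv_smul hne w _).1 rfl).symm

/-- **Theorem 3.** With `A = ḧ + h φ̇²`, `B = 2 ḣ φ̇ + h φ̈` and
`A² − B² ≠ 0`, there is a unique acceleration pole `q`, the point at which the
sliding acceleration `b_f = (x − p)(A + jB) e^{jφ} − ṗ (ḣ + j h φ̇) e^{jφ}`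
vanishes, namely `q = p + ṗ (ḣ + j h φ̇)(A − jB)/(A² − B²)`. -/
theorem acceleration_pole
    (h φ : ℝ → ℝ) (u p : ℝ → Hyp)
    (hh : Differentiable ℝ h) (hh' : Differentiable ℝ (deriv h))
    (hφ : Differentiable ℝ φ) (hφ' : Differentiable ℝ (deriv φ))
    (hu : Differentiable ℝ u) (hu' : Differentiable ℝ (deriv u))
    (hp : Differentiable ℝ p) (hp' : Differentiable ℝ (deriv p))
    (hpole : ∀ t, hmul (deriv h t, h t * deriv φ t) (p t)
      = deriv u t + hmul (0, deriv φ t) (u t))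
    (t : ℝ) (A B : ℝ)
    (hA : A = deriv (deriv h) t + h t * (deriv φ t) ^ 2)
    (hB : B = 2 * deriv h t * deriv φ t + h t * deriv (deriv φ) t)
    (hne : A ^ 2 - B ^ 2 ≠ 0) :
    ∀ q : Hyp,
      hmul (hmul (q - p t) (A, B)) (hexp (φ t))
          - hmul (hmul (deriv p t) (deriv h t, h t * deriv φ t)) (hexp (φ t)) = 0 ↔
      q = p t + (A ^ 2 - B ^ 2)⁻¹ •
            hmul (hmul (deriv p t) (deriv h t, h t * deriv φ t)) (A, -B) := by
  intro q
  rw [sub_eq_zero, hmul_hexp_left_inj, hmul_eq_iff_eq_inv_smul hne, sub_eq_iff_eq_add']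
end

section
/- Let φ : ℝ → ℝ and u, p : ℝ → ℝ² be twice differentiable, take homothetic scale h identically 1, suppose the pole identity j φ̇·p = u̇ + j φ̇·u holds for all t, and fix t with φ̈(t)² − φ̇(t)⁴ ≠ 0. Then the acceleration pole, i.e. the unique hyperbolic number q with (q − p)·(φ̇² + j φ̈) = ṗ·j φ̇, is given by q = p + ṗ·(φ̇ φ̈ − j φ̇³)/(φ̈² − φ̇⁴) (hyperbolic-number products, all functions evaluated at t). -/
/-- For `h ≡ 1` and `φ̈² − φ̇⁴ ≠ 0`, the acceleration pole,
i.e. the unique hyperbolic number `q` with `(q − p)(φ̇² + j φ̈) = ṗ j φ̇`, is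
`q = p + ṗ (φ̇ φ̈ − j φ̇³)/(φ̈² − φ̇⁴)`. -/
theorem acceleration_pole_h_eq_one
    (φ : ℝ → ℝ) (u p : ℝ → Hyp)
    (hφ : Differentiable ℝ φ) (hφ' : Differentiable ℝ (deriv φ))
    (hu : Differentiable ℝ u) (hu' : Differentiable ℝ (deriv u))
    (hp : Differentiable ℝ p) (hp' : Differentiable ℝ (deriv p))
    (hpole : ∀ t, hmul (0, deriv φ t) (p t)
      = deriv u t + hmul (0, deriv φ t) (u t))
    (t : ℝ)
    (hne : (deriv (deriv φ) t) ^ 2 - (deriv φ t) ^ 4 ≠ 0) :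
    ∀ q : Hyp,
      hmul (q - p t) ((deriv φ t) ^ 2, deriv (deriv φ) t)
          = hmul (deriv p t) (0, deriv φ t) ↔
      q = p t + ((deriv (deriv φ) t) ^ 2 - (deriv φ t) ^ 4)⁻¹ •
            hmul (deriv p t)
              (deriv φ t * deriv (deriv φ) t, -(deriv φ t) ^ 3) := by
  intro q
  generalize deriv (deriv φ) t = b at hne ⊢
  generalize deriv φ t = a at hne ⊢
  generalize deriv p t = w
  generalize p t = c
  obtain ⟨q₁, q₂⟩ := q
  obtain ⟨w₁, w₂⟩ := w
  obtain ⟨c₁, c₂⟩ := c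
  simp only [hmul, Prod.ext_iff, Prod.fst_add, Prod.snd_add, Prod.fst_sub, Prod.snd_sub,
    Prod.smul_fst, Prod.smul_snd, smul_eq_mul]
  rw [← sub_eq_iff_eq_add' (a := q₁), ← sub_eq_iff_eq_add' (a := q₂),
    eq_inv_mul_iff_mul_eq₀ hne, eq_inv_mul_iff_mul_eq₀ hne]
  constructor
  · rintro ⟨h₁, h₂⟩
    constructor
    · linear_combination b * h₂ - a ^ 2 * h₁
    · linear_combination b * h₁ - a ^ 2 * h₂
  · rintro ⟨h₁, h₂⟩
    constructor <;> apply mul_left_cancel₀ hne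
    · linear_combination a ^ 2 * h₁ + b * h₂
    · linear_combination b * h₁ + a ^ 2 * h₂
end

section
/- Let σ, σ' be hyperbolic numbers and let h ≠ 0 and τ ≠ τ' be real numbers. Then there is a unique hyperbolic number p such that (σ' − σ) + j·h·(τ' − τ)·p = 0 (i.e. the sliding differential d_f x = [(σ' − σ) + j h (τ' − τ) x̃] e^{jψ} vanishes at x̃ = p), namely p = j·(σ' − σ)/(h·(τ − τ')), with coordinates p₁ = (σ'₂ − σ₂)/(h(τ − τ')) and p₂ = (σ'₁ − σ₁)/(h(τ − τ')). -/
/-- In the canonical relative system, for `h ≠ 0` and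
`τ ≠ τ'` there is a unique pole `p` with `(σ' − σ) + j h (τ' − τ) p = 0`
(vanishing of the sliding differential), namely `p = j (σ' − σ)/(h(τ − τ'))`,
with coordinates `p₁ = (σ'₂ − σ₂)/(h(τ − τ'))`, `p₂ = (σ'₁ − σ₁)/(h(τ − τ'))`. -/
theorem canonical_relative_system_pole
    (σ σ' : Hyp) (h τ τ' : ℝ) (hh : h ≠ 0) (hττ' : τ ≠ τ') :
    (∀ p : Hyp,
        (σ' - σ) + hmul (0, h * (τ' - τ)) p = 0 ↔
          p = (h * (τ - τ'))⁻¹ • hmul jh (σ' - σ)) ∧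
    (h * (τ - τ'))⁻¹ • hmul jh (σ' - σ)
      = ((σ'.2 - σ.2) / (h * (τ - τ')), (σ'.1 - σ.1) / (h * (τ - τ'))) := by
  have hk : h * (τ - τ') ≠ 0 := mul_ne_zero hh (sub_ne_zero.mpr hττ')
  have hcoord : (h * (τ - τ'))⁻¹ • hmul jh (σ' - σ)
      = ((σ'.2 - σ.2) / (h * (τ - τ')), (σ'.1 - σ.1) / (h * (τ - τ'))) := by
    ext <;> simp [hmul, jh, div_eq_inv_mul]
  refine ⟨fun p => ?_, hcoord⟩
  rw [hcoord, Prod.ext_iff, Prod.ext_iff, eq_div_iff hk, eq_div_iff hk]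
  simp only [hmul, Prod.fst_add, Prod.snd_add, Prod.fst_sub, Prod.snd_sub, Prod.fst_zero,
    Prod.snd_zero]
  constructor
  · rintro ⟨h₁, h₂⟩
    constructor <;> linarith
  · rintro ⟨h₁, h₂⟩
    constructor <;> linarith
end

section
/- Let X, X', D, D', Σ be hyperbolic numbers and let H ≠ 0, dH, T, T' be real numbers. Assume the fixedness conditions H·D = −Σ − (dH + j·H·T)·X and H·D' = −Σ − (dH + j·H·T')·X' (hyperbolic-number products), and assume D·X' − X·D' = 0. Then Σ·(X − X') + j·H·(T' − T)·X·X' = 0. -/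
/-- If `X` is fixed on the moving plane,
`H D = −Σ − (dH + j H T) X`, and `X'` is fixed on the fixed plane,
`H D' = −Σ − (dH + j H T') X'`, and the pole rays remain proportional,
`D X' − X D' = 0`, then `Σ (X − X') + j H (T' − T) X X' = 0`.
(Here `Sig` denotes the hyperbolic Pfaffian form `Σ`.) -/
theorem euler_savary_key_identity
    (X X' D D' Sig : Hyp) (H dH T T' : ℝ) (hH : H ≠ 0)
    (hfix : H • D = -Sig - hmul (dH, H * T) X)
    (hfix' : H • D' = -Sig - hmul (dH, H * T') X')
    (hprop : hmul D X' - hmul X D' = 0) :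
    hmul Sig (X - X') + hmul (0, H * (T' - T)) (hmul X X') = 0 := by
  simp only [hmul, Prod.ext_iff, Prod.fst_add, Prod.snd_add, Prod.fst_sub, Prod.snd_sub,
    Prod.fst_neg, Prod.snd_neg, Prod.smul_fst, Prod.smul_snd, Prod.fst_zero, Prod.snd_zero,
    smul_eq_mul] at hfix hfix' hprop ⊢
  obtain ⟨a, b⟩ := hfix
  obtain ⟨a', b'⟩ := hfix'
  obtain ⟨p, q⟩ := hprop
  constructor
  · linear_combination H * p - X'.1 * a - X'.2 * b + X.1 * a' + X.2 * b'
  · linear_combination H * q - X'.2 * a - X'.1 * b + X.2 * a' + X.1 * b'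
end
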